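/- arXiv:1706.03611 — 8 statements merged into one kernel-verified Lean document; each statement's English description precedes it below -/
import Mathlib

section
/- Let G be a finite group, K a subgroup of G, α a normalized 3-cocycle on G, and β: K×K → U(1) a 2-cochain satisfying the Frobenius condition with respect to α. For g ∈ G and a,b,k ∈ K define the boundary vertex operator amplitude A(g,a,b,k) := α(g·k^{-1},k,a)·β(k,a)·α(g·k^{-1},k,b)^{-1}·β(k,b)^{-1}. Then for all g ∈ G and a,b,k,k' ∈ K one has A(g,a,b,k)·A(g·k^{-1}, k·a, k·b, k') = A(g,a,b,k'·k). (This expresses that the boundary vertex operators satisfy A^{k'}∘A^{k} = A^{k'k}, so that the averaged boundary vertex operator is a projector.) -/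
noncomputable section

/-- `α : G×G×G → U(1)` is a 3-cocycle. -/
def IsCocycle3 {G : Type*} [Group G] (α : G → G → G → Circle) : Prop :=
  ∀ g0 g1 g2 g3 : G,
    α g1 g2 g3 * (α (g0 * g1) g2 g3)⁻¹ * α g0 (g1 * g2) g3 *
      (α g0 g1 (g2 * g3))⁻¹ * α g0 g1 g2 = 1

/-- `α` is a normalized 3-cochain. -/
def IsNormalized3 {G : Type*} [Group G] (α : G → G → G → Circle) : Prop :=
  ∀ g h : G, α 1 g h = 1 ∧ α g 1 h = 1 ∧ α g h 1 = 1

/-- `γ : K×K → U(1)` is a 2-cocycle. -/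
def IsCocycle2 {K : Type*} [Group K] (γ : K → K → Circle) : Prop :=
  ∀ a b c : K, γ b c * (γ (a * b) c)⁻¹ * γ a (b * c) * (γ a b)⁻¹ = 1

/-- The Frobenius condition on a 2-cochain `β` on the subgroup `K`, with respect to the
3-cocycle `α` on `G`:  `α(a,b,c)·β(b,c)·β(a,bc)·β(ab,c)⁻¹·β(a,b)⁻¹ = 1` for all `a,b,c ∈ K`. -/
def FrobeniusCondition {G : Type*} [Group G] (K : Subgroup G)
    (α : G → G → G → Circle) (β : K → K → Circle) : Prop :=
  ∀ a b c : K, α ↑a ↑b ↑c * β b c * β a (b * c) * (β (a * b) c)⁻¹ * (β a b)⁻¹ = 1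

/-- The amplitude of the boundary vertex operator `A^k` acting on a boundary vertex with
adjacent bulk edge `g ∈ G` and boundary edges `a, b ∈ K`:
`A(g,a,b,k) = α(gk⁻¹,k,a)·β(k,a)·α(gk⁻¹,k,b)⁻¹·β(k,b)⁻¹`. -/
def boundaryAmplitude {G : Type*} [Group G] (K : Subgroup G)
    (α : G → G → G → Circle) (β : K → K → Circle)
    (g : G) (a b k : K) : Circle :=
  α (g * (↑k)⁻¹) ↑k ↑a * β k a * (α (g * (↑k)⁻¹) ↑k ↑b)⁻¹ * (β k b)⁻¹

/-- The cocycle identity at `(x, k', k, a)` combined with the Frobenius condition at `(k', k, a)`: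
the product of the two partial amplitudes at `a` depends on `a` only through `k' * k`. -/
theorem cocycle_mul_frobenius {G : Type*} [Group G] {K : Subgroup G}
    {α : G → G → G → Circle} (hα : IsCocycle3 α)
    {β : K → K → Circle} (hβ : FrobeniusCondition K α β) (x : G) (k' k a : K) :
    (α (x * k') k a * β k a) * (α x k' ↑(k * a) * β k' (k * a)) =
      (α x ↑(k' * k) a * β (k' * k) a) * (α x k' k * β k' k) := by
  have h₁ : α k' k a * α x ↑(k' * k) a * α x k' k = α (x * k') k a * α x k' ↑(k * a) := by
    rw [← div_eq_one, ← hα x k' k a]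
    push_cast
    simp only [div_eq_mul_inv, mul_inv]
    ac_rfl
  have h₂ : α k' k a * (β k a * β k' (k * a)) = β (k' * k) a * β k' k := by
    rw [← div_eq_one, ← hβ k' k a]
    simp only [div_eq_mul_inv, mul_inv]
    ac_rfl
  calc
    _ = (α (x * k') k a * α x k' ↑(k * a)) * (β k a * β k' (k * a)) := by
      rw [mul_mul_mul_comm]
    _ = (α x ↑(k' * k) a * α x k' k) * (α k' k a * (β k a * β k' (k * a))) := by
      rw [← h₁]; ac_rfl
    _ = _ := by rw [h₂, mul_mul_mul_comm]

/-- The boundary vertex operator amplitudes compose as `A^{k'} ∘ A^{k} = A^{k'k}`. -/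
theorem boundary_amplitude_composition
    {G : Type*} [Group G] [Fintype G] (K : Subgroup G)
    (α : G → G → G → Circle) (hα : IsCocycle3 α) (hαn : IsNormalized3 α)
    (β : K → K → Circle) (hβ : FrobeniusCondition K α β) :
    ∀ (g : G) (a b k k' : K),
      boundaryAmplitude K α β g a b k *
        boundaryAmplitude K α β (g * (↑k)⁻¹) (k * a) (k * b) k' =
      boundaryAmplitude K α β g a b (k' * k) := by
  intro g a b k k'
  have amplitude_eq_div (g : G) (a b k : K) : boundaryAmplitude K α β g a b k =
      (α (g * (↑k)⁻¹) k a * β k a) / (α (g * (↑k)⁻¹) k b * β k b) := by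
    rw [boundaryAmplitude, div_eq_mul_inv, mul_inv, mul_assoc]
  have hx : g * (↑(k' * k) : G)⁻¹ = g * (↑k)⁻¹ * (↑k')⁻¹ := by
    push_cast
    group
  have key := cocycle_mul_frobenius hα hβ (g * (↑k)⁻¹ * (↑k')⁻¹) k' k
  rw [inv_mul_cancel_right] at key
  rw [amplitude_eq_div, amplitude_eq_div, amplitude_eq_div, div_mul_div_comm, key a, key b, hx,
    mul_div_mul_right_eq_div]

end
end

section
/- Let G be a finite group and α a normalized 3-cocycle on G. Then for every h ∈ G the slant product β_h is a twisted 2-cocycle: for all x,y,z ∈ G, β_h(x,y)·β_h(xy,z) = β_{x^{-1}hx}(y,z)·β_h(x,yz). -/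
noncomputable section

/-- The slant product of a 3-cochain `α` with `h ∈ G`:
`β_h(x,y) = α(h,x,y)·α(x, x⁻¹hx, y)⁻¹·α(x, y, (xy)⁻¹h(xy))`. -/
def slantProduct {G : Type*} [Group G] (α : G → G → G → Circle) (h x y : G) : Circle :=
  α h x y * (α x (x⁻¹ * h * x) y)⁻¹ * α x y ((x * y)⁻¹ * h * (x * y))

/-- The slant product of a normalized 3-cocycle is a twisted 2-cocycle:
`β_h(x,y)·β_h(xy,z) = β_{x⁻¹hx}(y,z)·β_h(x,yz)`. -/
theorem slant_product_is_twisted_two_cocycle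
    {G : Type*} [Group G] [Fintype G]
    (α : G → G → G → Circle) (hα : IsCocycle3 α) (hαn : IsNormalized3 α) :
    ∀ h x y z : G,
      slantProduct α h x y * slantProduct α h (x * y) z =
        slantProduct α (x⁻¹ * h * x) y z * slantProduct α h x (y * z) := by
  intro h x y z
  obtain ⟨k, hk⟩ : ∃ k, k = x⁻¹ * h * x := ⟨_, rfl⟩
  obtain ⟨l, hl⟩ : ∃ l, l = y⁻¹ * k * y := ⟨_, rfl⟩
  obtain ⟨m, hm⟩ : ∃ m, m = z⁻¹ * l * z := ⟨_, rfl⟩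
  have hx : h * x = x * k := by rw [hk]; group
  have ky : k * y = y * l := by rw [hl]; group
  have lz : l * z = z * m := by rw [hm]; group
  have hxy : (x * y)⁻¹ * h * (x * y) = l := by rw [hl, hk]; group
  have kyz : (y * z)⁻¹ * k * (y * z) = m := by rw [hm, hl]; group
  have hxyz : (x * y * z)⁻¹ * h * (x * y * z) = m := by rw [hm, hl, hk]; group
  have hxyz' : (x * (y * z))⁻¹ * h * (x * (y * z)) = m := by rw [← mul_assoc x, hxyz]
  have d₁ := hα h x y z
  have d₂ := hα x k y z
  have d₃ := hα x y l z
  have d₄ := hα x y z m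
  rw [hx] at d₁
  rw [ky] at d₂
  rw [lz] at d₃
  simp only [slantProduct, hxy, hxyz, hxyz', ← hk, ← hl, kyz]
  apply Additive.ofMul.injective
  apply_fun Additive.ofMul at d₁ d₂ d₃ d₄
  simp only [ofMul_mul, ofMul_inv] at d₁ d₂ d₃ d₄ ⊢
  linear_combination (norm := abel) d₁ - d₂ + d₃ - d₄

end
end

section
/- Let G be a finite group, K₁ and K₂ subgroups of G, α a normalized 3-cocycle on G, and β₁: K₁×K₁ → U(1), β₂: K₂×K₂ → U(1) 2-cochains satisfying the Frobenius condition with respect to α. Let g ∈ G and y,k₂ ∈ K₂ with y·k₂ = k₂·y, and suppose x := g·y·g^{-1} and k₁ := g·k₂·g^{-1} both lie in K₁. Then the ground-state projector amplitude on the cylinder simplifies as follows: [α(g, k₂y^{-1}, y)·β₂(k₂y^{-1}, y)] / [α(k₁, gy^{-1}, y)·α(gy^{-1}, y, k₂y^{-1})·β₂(y, k₂y^{-1})] × [α(k₁x^{-1}, x, gy^{-1})·α(x, gy^{-1}, y·k₂·y^{-1})·β₁(x, k₁x^{-1})] / [α(x, k₁x^{-1}, x·g·y^{-1})·β₁(k₁x^{-1},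 x)] = [β₁(x, k₁)·β_{k₁}(x, gy^{-1}) / β₁(k₁, x)] × [β₂(k₂, y) / (β_{k₁}(gy^{-1}, y)·β₂(y, k₂))], where β_h denotes the slant product of α with h. -/
noncomputable section

/-- Simplification of the ground-state projector amplitude on the cylinder with boundary
conditions `(K₁,β₁)` and `(K₂,β₂)`, where `x = gyg⁻¹` and `k₁ = gk₂g⁻¹` lie in `K₁`. -/
theorem cylinder_projector_amplitude_simplification
    {G : Type*} [Group G] [Fintype G] (K₁ K₂ : Subgroup G)
    (α : G → G → G → Circle) (hα : IsCocycle3 α) (hαn : IsNormalized3 α)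
    (β₁ : K₁ → K₁ → Circle) (β₂ : K₂ → K₂ → Circle)
    (hβ₁ : FrobeniusCondition K₁ α β₁) (hβ₂ : FrobeniusCondition K₂ α β₂)
    (g : G) (y k₂ : K₂) (hcomm : y * k₂ = k₂ * y)
    (x k₁ : K₁) (hx : (x : G) = g * ↑y * g⁻¹) (hk : (k₁ : G) = g * ↑k₂ * g⁻¹) :
    (α g ↑(k₂ * y⁻¹) ↑y * β₂ (k₂ * y⁻¹) y) /
        (α ↑k₁ (g * (↑y)⁻¹) ↑y * α (g * (↑y)⁻¹) ↑y ↑(k₂ * y⁻¹) * β₂ y (k₂ * y⁻¹)) *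
      ((α ↑(k₁ * x⁻¹) ↑x (g * (↑y)⁻¹) * α ↑x (g * (↑y)⁻¹) (↑y * ↑k₂ * (↑y)⁻¹) *
          β₁ x (k₁ * x⁻¹)) /
        (α ↑x ↑(k₁ * x⁻¹) (↑x * g * (↑y)⁻¹) * β₁ (k₁ * x⁻¹) x)) =
    (β₁ x k₁ * slantProduct α ↑k₁ ↑x (g * (↑y)⁻¹) / β₁ k₁ x) *
      (β₂ k₂ y / (slantProduct α ↑k₁ (g * (↑y)⁻¹) ↑y * β₂ y k₂)) := by
  have hyk : (y : G) * k₂ = k₂ * y := congrArg Subtype.val hcomm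
  have hp : y * (k₂ * y⁻¹) = k₂ := by rw [← mul_assoc, hcomm, mul_inv_cancel_right]
  have hyk' : (y : G) * (k₂ * (y : G)⁻¹) = k₂ := by
    rw [← mul_assoc, hyk, mul_inv_cancel_right]
  have hxk : x * k₁ = k₁ * x := by
    apply Subtype.ext
    simp only [Subgroup.coe_mul, hx, hk]
    calc g * y * g⁻¹ * (g * k₂ * g⁻¹) = g * ((y : G) * k₂) * g⁻¹ := by group
      _ = g * ((k₂ : G) * y) * g⁻¹ := by rw [hyk]
      _ = _ := by group
  have hq : x * (k₁ * x⁻¹) = k₁ := by rw [← mul_assoc, hxk, mul_inv_cancel_right]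
  have hxq : (x : G) * ↑(k₁ * x⁻¹) = k₁ := congrArg Subtype.val hq
  have hqx : (↑(k₁ * x⁻¹) : G) * x = k₁ := congrArg Subtype.val (inv_mul_cancel_right k₁ x)
  have hyp : (y : G) * ↑(k₂ * y⁻¹) = k₂ := congrArg Subtype.val hp
  have hpy : (↑(k₂ * y⁻¹) : G) * y = k₂ := congrArg Subtype.val (inv_mul_cancel_right k₂ y)
  have hxw : (x : G) * (g * (y : G)⁻¹) = g := by rw [hx]; group
  have hxg : (x : G) * g * (y : G)⁻¹ = g := by rw [mul_assoc, hxw]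
  have hwy : g * (y : G)⁻¹ * y = g := inv_mul_cancel_right g _
  have hyky : (y : G) * k₂ * (y : G)⁻¹ = k₂ := by rw [mul_assoc, hyk']
  have hgk : g⁻¹ * k₁ * g = k₂ := by rw [hk]; group
  have hwk : (g * (y : G)⁻¹)⁻¹ * k₁ * (g * (y : G)⁻¹) = k₂ := by
    calc (g * (y : G)⁻¹)⁻¹ * k₁ * (g * (y : G)⁻¹) = y * (g⁻¹ * k₁ * g) * (y : G)⁻¹ := by group
      _ = k₂ := by rw [hgk, hyky]
  have hxkx : (x : G)⁻¹ * k₁ * x = k₁ := by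
    have h : (x : G) * k₁ = k₁ * x := congrArg Subtype.val hxk
    rw [mul_assoc, ← h, inv_mul_cancel_left]
  have hF₁ := hβ₁ x (k₁ * x⁻¹) x
  rw [hq, inv_mul_cancel_right] at hF₁
  have hF₂ := hβ₂ y (k₂ * y⁻¹) y
  rw [hp, inv_mul_cancel_right] at hF₂
  have hC₁ := hα x ↑(k₁ * x⁻¹) x (g * (y : G)⁻¹)
  rw [hxq, hqx, hxw] at hC₁
  have hC₂ := hα (g * (y : G)⁻¹) y ↑(k₂ * y⁻¹) y
  rw [hwy, hyp, hpy] at hC₂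
  simp only [slantProduct]
  rw [hxg, hyky, hxw, hwy, hgk, hwk, hxkx]
  apply Additive.ofMul.injective
  apply_fun Additive.ofMul at hF₁ hF₂ hC₁ hC₂
  simp only [ofMul_mul, ofMul_div, ofMul_inv, ofMul_one] at hF₁ hF₂ hC₁ hC₂ ⊢
  linear_combination (norm := module) hF₂ - hF₁ + hC₁ - hC₂

end
end

section
/- Let G = Z₂ = {0,1} (written additively) and let α be the doubled-semion 3-cocycle on G defined by α(1,1,1) = −1 and α(a,b,c) = 1 whenever at least one of a,b,c is 0. Then α is a normalized 3-cocycle on Z₂, and there exists NO 2-cochain β: Z₂×Z₂ → U(1) satisfying the Frobenius condition with respect to α for K = Z₂. (Hence the doubled semion model admits only the trivial boundary subgroup K = {0}.) -/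
noncomputable section

/-- The doubled-semion 3-cocycle on `Z₂`: `α(1,1,1) = −1` on the three nontrivial arguments
and `α = 1` whenever one of the arguments is the identity. -/
noncomputable def doubledSemionCocycle :
    Multiplicative (ZMod 2) → Multiplicative (ZMod 2) → Multiplicative (ZMod 2) → Circle :=
  fun a b c =>
    if a = 1 ∨ b = 1 ∨ c = 1 then 1
    else ⟨-1, by norm_num [Submonoid.unitSphere, Metric.mem_sphere]⟩

theorem Multiplicative.zmod_two_cases (a : Multiplicative (ZMod 2)) :
    a = 1 ∨ a = Multiplicative.ofAdd 1 := by
  revert a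
  decide

theorem Multiplicative.ofAdd_one_zmod_two_mul_self :
    (Multiplicative.ofAdd 1 * Multiplicative.ofAdd 1 : Multiplicative (ZMod 2)) = 1 := by
  decide

theorem isNormalized3_doubledSemionCocycle : IsNormalized3 doubledSemionCocycle := by
  intro g h
  simp [doubledSemionCocycle]

theorem coe_doubledSemionCocycle_ofAdd_one :
    (doubledSemionCocycle (Multiplicative.ofAdd 1) (Multiplicative.ofAdd 1)
      (Multiplicative.ofAdd 1) : ℂ) = -1 :=
  congrArg Subtype.val (if_neg (by decide))

theorem isCocycle3_doubledSemionCocycle : IsCocycle3 doubledSemionCocycle := by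
  have h1 (g h) : doubledSemionCocycle 1 g h = 1 := (isNormalized3_doubledSemionCocycle g h).1
  have h2 (g h) : doubledSemionCocycle g 1 h = 1 := (isNormalized3_doubledSemionCocycle g h).2.1
  have h3 (g h) : doubledSemionCocycle g h 1 = 1 := (isNormalized3_doubledSemionCocycle g h).2.2
  have hsq : doubledSemionCocycle (Multiplicative.ofAdd 1) (Multiplicative.ofAdd 1)
      (Multiplicative.ofAdd 1) * doubledSemionCocycle (Multiplicative.ofAdd 1)
      (Multiplicative.ofAdd 1) (Multiplicative.ofAdd 1) = 1 := by
    apply Circle.ext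
    rw [Circle.coe_mul, coe_doubledSemionCocycle_ofAdd_one]
    simp
  intro a b c d
  rcases Multiplicative.zmod_two_cases a with rfl | rfl <;>
  rcases Multiplicative.zmod_two_cases b with rfl | rfl <;>
  rcases Multiplicative.zmod_two_cases c with rfl | rfl <;>
  rcases Multiplicative.zmod_two_cases d with rfl | rfl <;>
  simp only [Multiplicative.ofAdd_one_zmod_two_mul_self, h1, h2, h3, hsq, one_mul, mul_one,
    inv_one, mul_inv_cancel, inv_mul_cancel]

/-- The doubled-semion cocycle is a normalized 3-cocycle on `Z₂`, and there is NO 2-cochain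
`β` on `K = Z₂` satisfying the Frobenius condition with respect to it. -/
theorem doubled_semion_no_full_boundary :
    IsNormalized3 doubledSemionCocycle ∧ IsCocycle3 doubledSemionCocycle ∧
      ¬ ∃ β : Multiplicative (ZMod 2) → Multiplicative (ZMod 2) → Circle,
          ∀ a b c : Multiplicative (ZMod 2),
            doubledSemionCocycle a b c * β b c * β a (b * c) *
              (β (a * b) c)⁻¹ * (β a b)⁻¹ = 1 := by
  refine ⟨isNormalized3_doubledSemionCocycle, isCocycle3_doubledSemionCocycle, ?_⟩
  rintro ⟨β, hβ⟩
  set s : Multiplicative (ZMod 2) := Multiplicative.ofAdd 1 with hs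
  have hss : s * s = 1 := Multiplicative.ofAdd_one_zmod_two_mul_self
  have hleft : β 1 s = β 1 1 := by
    have h := hβ 1 1 s
    rw [(isNormalized3_doubledSemionCocycle 1 s).1] at h
    simpa [mul_inv_eq_one] using h
  have hright : β s 1 = β 1 1 := by
    have h := hβ s 1 1
    rw [(isNormalized3_doubledSemionCocycle s 1).2.1] at h
    exact (mul_inv_eq_one.mp (by simpa using h)).symm
  have h := hβ s s s
  rw [hss, hleft, hright, mul_inv_eq_one, mul_inv_eq_iff_eq_mul, mul_assoc,
    mul_comm (β s s) (β 1 1), mul_eq_right] at h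
  have hneg := coe_doubledSemionCocycle_ofAdd_one
  rw [← hs, h] at hneg
  norm_num at hneg

end
end

section
/- For every positive integer m and every integer p, the function α^p on the dihedral group D_m defined by α^p((A,a),(B,b),(C,c)) = exp( (2πip/m²)·[ (−1)^{B+C}·ã·( (−1)^{C}·b̃ + c̃ − [ (−1)^{C}·b̃ + c̃ ]_m ) + (m²/2)·Ã·B̃·C̃ ] ) is a normalized 3-cocycle on D_m. -/
noncomputable section

/-- The reflection degree: `0` on rotations `(0,a)` and `1` on reflections `(1,a)`. -/
def reflDeg {m : ℕ} : DihedralGroup m → ℕ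
  | .r _ => 0
  | .sr _ => 1

/-- The integer representative (in `{0,…,m-1}`) of the rotation part of a dihedral element. -/
def rotDeg {m : ℕ} : DihedralGroup m → ℤ
  | .r i => i.val
  | .sr i => i.val

/-- The dihedral 3-cocycle `α^p` on `D_m`:
`α^p((A,a),(B,b),(C,c)) = exp( (2πip/m²)·[ (−1)^{B+C}·ã·((−1)^C·b̃ + c̃ − [(−1)^C·b̃ + c̃]_m)
  + (m²/2)·Ã·B̃·C̃ ] )`. -/
noncomputable def dihedralCocycle (m : ℕ) (p : ℤ) (x y z : DihedralGroup m) : Circle :=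
  Circle.exp ((2 * Real.pi * (p : ℝ) / (m : ℝ) ^ 2) *
    ((-1 : ℝ) ^ (reflDeg y + reflDeg z) * (rotDeg x : ℝ) *
        (((((-1 : ℤ) ^ reflDeg z * rotDeg y + rotDeg z) -
          ((-1 : ℤ) ^ reflDeg z * rotDeg y + rotDeg z) % (m : ℤ)) : ℤ) : ℝ) +
      (m : ℝ) ^ 2 / 2 * (reflDeg x : ℝ) * (reflDeg y : ℝ) * (reflDeg z : ℝ)))

/-- The parity sign `1` on rotations and `-1` on reflections. -/
def reflSign {m : ℕ} (x : DihedralGroup m) : ℤ := (-1) ^ reflDeg x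

/-- The failure of the integer representatives of rotation parts to be multiplicative. -/
def rotCarry {m : ℕ} (x y : DihedralGroup m) : ℤ :=
  reflSign y * rotDeg x + rotDeg y - rotDeg (x * y)

/-- The phase of the dihedral cocycle, before scaling by `2πp/m²`. -/
def dihedralPhase (m : ℕ) (x y z : DihedralGroup m) : ℝ :=
  ((reflSign (y * z) * rotDeg x * rotCarry y z : ℤ) : ℝ) +
    (m : ℝ) ^ 2 / 2 * ((reflDeg x * reflDeg y * reflDeg z : ℤ) : ℝ)

theorem reflSign_mul {m : ℕ} (x y : DihedralGroup m) :
    reflSign (x * y) = reflSign x * reflSign y := by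
  cases x <;> cases y <;> simp [reflSign, reflDeg]

theorem reflDeg_mul {m : ℕ} (x y : DihedralGroup m) :
    (reflDeg (x * y) : ℤ) = reflDeg x + reflDeg y - 2 * reflDeg x * reflDeg y := by
  cases x <;> cases y <;> simp [reflDeg]

theorem rotDeg_mul {m : ℕ} (hm : 0 < m) (x y : DihedralGroup m) :
    rotDeg (x * y) = (reflSign y * rotDeg x + rotDeg y) % (m : ℤ) := by
  have : NeZero m := ⟨hm.ne'⟩
  have val_eq (i : ZMod m) (n : ℤ) (h : i = (n : ZMod m)) : (i.val : ℤ) = n % m := by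
    rw [h, ZMod.val_intCast]
  cases x <;> cases y <;> apply val_eq <;>
    simp [reflSign, reflDeg, rotDeg, sub_eq_neg_add]

theorem dvd_rotCarry {m : ℕ} (hm : 0 < m) (x y : DihedralGroup m) :
    (m : ℤ) ∣ rotCarry x y := by
  rw [rotCarry, rotDeg_mul hm]
  exact Int.dvd_self_sub_emod

theorem rotCarry_cocycle {m : ℕ} (x y z : DihedralGroup m) :
    rotCarry y z - rotCarry (x * y) z + rotCarry x (y * z) - reflSign z * rotCarry x y = 0 := by
  simp only [rotCarry, reflSign_mul, mul_assoc]
  ring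

theorem dihedralCocycle_eq_exp_phase {m : ℕ} (hm : 0 < m) (p : ℤ) (x y z : DihedralGroup m) :
    dihedralCocycle m p x y z =
      Circle.exp ((2 * Real.pi * p / (m : ℝ) ^ 2) * dihedralPhase m x y z) := by
  simp only [dihedralCocycle, dihedralPhase, rotCarry, reflSign_mul, rotDeg_mul hm]
  congr 2
  simp only [reflSign]
  push_cast
  ring

/-- The coboundary of the phase is the cup square of the carry plus `m²` times the product
of the reflection degrees. -/
theorem dihedralPhase_coboundary {m : ℕ} (w x y z : DihedralGroup m) :
    dihedralPhase m x y z - dihedralPhase m (w * x) y z + dihedralPhase m w (x * y) z -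
        dihedralPhase m w x (y * z) + dihedralPhase m w x y =
      ((reflSign (y * z) * rotCarry w x * rotCarry y z +
        (m : ℤ) ^ 2 * (reflDeg w * reflDeg x * reflDeg y * reflDeg z) : ℤ) : ℝ) := by
  have hsq : reflSign z * reflSign z = 1 := by cases z <;> simp [reflSign, reflDeg]
  have hrot : reflSign (y * z) * rotDeg x * rotCarry y z
        - reflSign (y * z) * rotDeg (w * x) * rotCarry y z
        + reflSign (x * y * z) * rotDeg w * rotCarry (x * y) z
        - reflSign (x * (y * z)) * rotDeg w * rotCarry x (y * z)
        + reflSign (x * y) * rotDeg w * rotCarry x y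
      = reflSign (y * z) * rotCarry w x * rotCarry y z := by
    have hwx : rotDeg (w * x) = reflSign x * rotDeg w + rotDeg x - rotCarry w x := by
      simp only [rotCarry]; ring
    rw [hwx]
    simp only [reflSign_mul]
    linear_combination (-(reflSign x * reflSign y * reflSign z * rotDeg w)) *
      rotCarry_cocycle x y z - reflSign x * reflSign y * rotDeg w * rotCarry x y * hsq
  have hrefl : (reflDeg x * reflDeg y * reflDeg z - reflDeg (w * x) * reflDeg y * reflDeg z
        + reflDeg w * reflDeg (x * y) * reflDeg z - reflDeg w * reflDeg x * reflDeg (y * z)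
        + reflDeg w * reflDeg x * reflDeg y : ℤ)
      = 2 * (reflDeg w * reflDeg x * reflDeg y * reflDeg z) := by
    simp only [reflDeg_mul]; ring
  have hrot' := congrArg (Int.cast : ℤ → ℝ) hrot
  have hrefl' := congrArg (Int.cast : ℤ → ℝ) hrefl
  simp only [dihedralPhase]
  push_cast at hrot' hrefl' ⊢
  linear_combination hrot' + (m : ℝ) ^ 2 / 2 * hrefl'

theorem dihedralCocycle_isNormalized3 {m : ℕ} (hm : 0 < m) (p : ℤ) :
    IsNormalized3 (dihedralCocycle m p) := by
  have deg_one : reflDeg (1 : DihedralGroup m) = 0 := rfl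
  have rot_one : rotDeg (1 : DihedralGroup m) = 0 := by
    change (((0 : ZMod m).val : ℕ) : ℤ) = 0
    simp
  intro g h
  simp [dihedralCocycle_eq_exp_phase hm, dihedralPhase, rotCarry, reflSign, deg_one, rot_one]

theorem dihedralCocycle_isCocycle3 {m : ℕ} (hm : 0 < m) (p : ℤ) :
    IsCocycle3 (dihedralCocycle m p) := by
  intro w x y z
  obtain ⟨k, hk⟩ := dvd_rotCarry hm w x
  obtain ⟨l, hl⟩ := dvd_rotCarry hm y z
  have hm' : (m : ℝ) ≠ 0 := by exact_mod_cast hm.ne'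
  simp only [dihedralCocycle_eq_exp_phase hm, ← Circle.exp_neg, ← Circle.exp_add]
  rw [Circle.exp_eq_one]
  refine ⟨p * (reflSign (y * z) * k * l + reflDeg w * reflDeg x * reflDeg y * reflDeg z), ?_⟩
  have h := dihedralPhase_coboundary w x y z
  rw [hk, hl] at h
  trans (2 * Real.pi * p / (m : ℝ) ^ 2) * (dihedralPhase m x y z - dihedralPhase m (w * x) y z +
    dihedralPhase m w (x * y) z - dihedralPhase m w x (y * z) + dihedralPhase m w x y)
  · ring
  · rw [h]
    push_cast
    field_simp

/-- For every positive `m` and every integer `p`, the dihedral cochain `α^p` is a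
normalized 3-cocycle on `D_m`. -/
theorem dihedralCocycle_is_normalized_three_cocycle (m : ℕ) (hm : 0 < m) (p : ℤ) :
    IsNormalized3 (dihedralCocycle m p) ∧ IsCocycle3 (dihedralCocycle m p) := by
  exact ⟨dihedralCocycle_isNormalized3 hm p, dihedralCocycle_isCocycle3 hm p⟩

end
end

section
/- Let G = D₃ (dihedral group of order 6) and let α^p be the 3-cocycle on D₃ given by the dihedral cocycle formula with m = 3, for p ∈ {0,1,2,3,4,5}. Let K = {(0,a) : a ∈ Z₃} ≅ Z₃ be the rotation subgroup. Then there exists a 2-cochain β: K×K → U(1) satisfying the Frobenius condition with respect to α^p if and only if p ≡ 0 (mod 3); moreover, when p ≡ 0 (mod 3) the restriction of α^p to K is identically 1, so β ≡ 1 is a solution. -/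
noncomputable section

/-- The rotation subgroup `{(0,a) : a ∈ Z_m} ≅ Z_m` of the dihedral group `D_m`. -/
def rotationSubgroup (m : ℕ) : Subgroup (DihedralGroup m) where
  carrier := {x | ∃ i, x = .r i}
  one_mem' := ⟨0, rfl⟩
  mul_mem' := by rintro _ _ ⟨i, rfl⟩ ⟨j, rfl⟩; exact ⟨i + j, by rw [DihedralGroup.r_mul_r]⟩
  inv_mem' := by rintro _ ⟨i, rfl⟩; exact ⟨-i, rfl⟩

/-- If `m ∣ p`, then the dihedral cocycle `α^p` is trivial on rotations. -/
theorem dihedralCocycle_r_eq_one {m : ℕ} [NeZero m] {p : ℤ} (hp : (m : ℤ) ∣ p)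
    (i j k : ZMod m) : dihedralCocycle m p (.r i) (.r j) (.r k) = 1 := by
  obtain ⟨q, rfl⟩ := hp
  obtain ⟨t, ht⟩ : (m : ℤ) ∣ (j.val + k.val : ℤ) - (j.val + k.val : ℤ) % m :=
    Int.dvd_self_sub_emod
  have hm : (m : ℝ) ≠ 0 := Nat.cast_ne_zero.mpr (NeZero.ne m)
  rw [dihedralCocycle, Circle.exp_eq_one]
  refine ⟨q * i.val * t, ?_⟩
  simp only [reflDeg, rotDeg, pow_zero, one_mul, ht]
  push_cast
  field_simp
  ring

/-- If the Frobenius condition is solvable on `K`, then the product of `α(g, g^j, g)` over a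
full period of `g` is trivial. -/
theorem FrobeniusCondition.prod_eq_one {G : Type*} [Group G] {K : Subgroup G}
    {α : G → G → G → Circle} {β : K → K → Circle} (h : FrobeniusCondition K α β)
    {g : K} {n : ℕ} (hg : g ^ n = 1) :
    ∏ j ∈ Finset.range n, α g ↑(g ^ j) g = 1 := by
  have quotient_eq (j : ℕ) : α g ↑(g ^ j) g =
      (β (g ^ (j + 1)) g / β g (g ^ (j + 1))) / (β (g ^ j) g / β g (g ^ j)) := by
    have hj := h g (g ^ j) g
    rw [← pow_succ, ← pow_succ', mul_inv_eq_one, mul_inv_eq_iff_eq_mul] at hj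
    rw [div_div_div_eq, eq_div_iff_mul_eq', mul_comm (β g _) (β (g ^ j) g),
      mul_comm (β (g ^ (j + 1)) g), ← hj, mul_assoc]
  simp only [quotient_eq]
  rw [Finset.prod_range_div (fun j => β (g ^ j) g / β g (g ^ j))]
  simp [hg]

/-- For `G = D₃`, `K` the rotation subgroup `Z₃`, and `p ∈ {0,…,5}`: the Frobenius
condition for `α^p` is solvable on `K` iff `p ≡ 0 (mod 3)`, in which case the restriction
of `α^p` to `K` is identically `1` and `β ≡ 1` is a solution. -/
theorem d3_rotation_subgroup_boundary (p : ℤ) (hp : 0 ≤ p ∧ p ≤ 5) :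
    ((∃ β : rotationSubgroup 3 → rotationSubgroup 3 → Circle,
        FrobeniusCondition (rotationSubgroup 3) (dihedralCocycle 3 p) β) ↔ p % 3 = 0) ∧
    (p % 3 = 0 →
      (∀ a b c : rotationSubgroup 3, dihedralCocycle 3 p ↑a ↑b ↑c = 1) ∧
      FrobeniusCondition (rotationSubgroup 3) (dihedralCocycle 3 p) fun _ _ => 1) := by
  have trivial_of_dvd (h : p % 3 = 0) (a b c : rotationSubgroup 3) :
      dihedralCocycle 3 p ↑a ↑b ↑c = 1 := by
    obtain ⟨_, i, rfl⟩ := a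
    obtain ⟨_, j, rfl⟩ := b
    obtain ⟨_, k, rfl⟩ := c
    exact dihedralCocycle_r_eq_one (Int.dvd_of_emod_eq_zero h) i j k
  have frobenius_one (h : p % 3 = 0) :
      FrobeniusCondition (rotationSubgroup 3) (dihedralCocycle 3 p) fun _ _ => 1 := by
    intro a b c
    simp [trivial_of_dvd h a b c]
  refine ⟨⟨?_, fun h => ⟨_, frobenius_one h⟩⟩, fun h => ⟨trivial_of_dvd h, frobenius_one h⟩⟩
  rintro ⟨β, hβ⟩
  have hg : (⟨.r 1, 1, rfl⟩ : rotationSubgroup 3) ^ 3 = 1 :=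
    Subtype.ext (DihedralGroup.r_one_pow_n (n := 3))
  have hprod := hβ.prod_eq_one hg
  have h0 : (0 : ZMod 3).val = 0 := rfl
  have h1 : (1 : ZMod 3).val = 1 := rfl
  have h2 : (2 : ZMod 3).val = 2 := rfl
  simp only [Finset.prod_range_succ, Finset.prod_range_zero, one_mul, SubmonoidClass.coe_pow,
    DihedralGroup.r_one_pow, dihedralCocycle, reflDeg, rotDeg, Nat.cast_zero, Nat.cast_one,
    Nat.cast_ofNat, h0, h1, h2, ← Circle.exp_add] at hprod
  rw [Circle.exp_eq_one] at hprod
  obtain ⟨n, hn⟩ := hprod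
  norm_num at hn
  have hp3 : (p : ℝ) = 3 * n := by
    have := Real.pi_ne_zero
    field_simp at hn
    linarith
  have : p = 3 * n := by exact_mod_cast hp3
  omega

end
end

section
/- Let G = D₃ (dihedral group of order 6) and let α^p be the 3-cocycle on D₃ given by the dihedral cocycle formula with m = 3. For K = G = D₃, there exists a 2-cochain β: D₃×D₃ → U(1) satisfying the Frobenius condition with respect to α^p if and only if p ≡ 0 (mod 6); equivalently, for p ∈ {1,2,3,4,5} the 3-cocycle α^p is not a 3-coboundary on D₃. -/
noncomputable section

/-- `β` trivializes `α`: the Frobenius condition on the whole group, for arbitrary coefficients. -/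
def Trivializes {G M : Type*} [Group G] [CommGroup M] (α : G → G → G → M) (β : G → G → M) : Prop :=
  ∀ a b c : G, α a b c * β b c * β a (b * c) * (β (a * b) c)⁻¹ * (β a b)⁻¹ = 1

/-- A trivializable cochain that is normalized at `s` takes the value `1` at `(s, s, s)` whenever
`s` is an involution. -/
lemma Trivializes.apply_involution {G M : Type*} [Group G] [CommGroup M] {α : G → G → G → M}
    {β : G → G → M} (h : Trivializes α β) {s : G} (hs : s * s = 1) (hl : α 1 1 s = 1)
    (hr : α s 1 1 = 1) : α s s s = 1 := by
  have hsss := h s s s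
  have h11s := h 1 1 s
  have hs11 := h s 1 1
  simp only [hs, hl, hr, one_mul, mul_one, mul_inv_cancel_right] at hsss h11s hs11
  have h1 : β 1 s = β 1 1 := mul_inv_eq_one.mp h11s
  have h2 : β 1 1 = β s 1 := mul_inv_eq_one.mp hs11
  rw [h1, ← h2] at hsss
  simpa [mul_assoc, mul_comm, mul_left_comm] using hsss

/-- The product of `α (g, g ^ k, g)` over a period of `g` is a cohomological invariant. -/
lemma Trivializes.prod_range_eq_one {G M : Type*} [Group G] [CommGroup M] {α : G → G → G → M}
    {β : G → G → M} (h : Trivializes α β) {g : G} {n : ℕ} (hg : g ^ n = 1) :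
    ∏ k ∈ Finset.range n, α g (g ^ k) g = 1 := by
  have key (k : ℕ) : α g (g ^ k) g =
      (β (g ^ (k + 1)) g / β g (g ^ (k + 1))) / (β (g ^ k) g / β g (g ^ k)) := by
    have hk := h g (g ^ k) g
    rw [← pow_succ, ← pow_succ'] at hk
    rw [← div_eq_one, ← hk]
    simp only [div_eq_mul_inv, mul_inv, inv_inv]
    simp only [mul_assoc, mul_comm, mul_left_comm]
  simp only [key]
  rw [Finset.prod_range_div (fun k => β (g ^ k) g / β g (g ^ k)), hg, pow_zero, div_self']

lemma dihedralCocycle_zero (m : ℕ) (x y z : DihedralGroup m) : dihedralCocycle m 0 x y z = 1 := by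
  simp [dihedralCocycle]

lemma dihedralCocycle_sr_zero {m : ℕ} [NeZero m] (p : ℤ) :
    dihedralCocycle m p (.sr 0) (.sr 0) (.sr 0) = Circle.exp (p * Real.pi) := by
  have hm : (m : ℝ) ≠ 0 := NeZero.ne _
  simp only [dihedralCocycle, reflDeg, rotDeg, ZMod.val_zero]
  congr 1
  field_simp
  simp

lemma dihedralCocycle_one_one {m : ℕ} (p : ℤ) (x : DihedralGroup m) :
    dihedralCocycle m p 1 1 x = 1 ∧ dihedralCocycle m p x 1 1 = 1 := by
  rw [DihedralGroup.one_def]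
  cases m <;> simp [dihedralCocycle, reflDeg, rotDeg]

lemma Circle.exp_int_mul_pi_eq_one {p : ℤ} (h : Circle.exp (p * Real.pi) = 1) : 2 ∣ p := by
  obtain ⟨k, hk⟩ := Circle.exp_eq_one.mp h
  refine ⟨k, ?_⟩
  have : (p : ℝ) = 2 * k := mul_right_cancel₀ Real.pi_ne_zero (by linarith)
  exact_mod_cast this

lemma Circle.exp_int_mul_two_pi_div_three_eq_one {p : ℤ}
    (h : Circle.exp (p * (2 * Real.pi / 3)) = 1) : 3 ∣ p := by
  obtain ⟨k, hk⟩ := Circle.exp_eq_one.mp h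
  refine ⟨k, ?_⟩
  have : (p : ℝ) = 3 * k := mul_right_cancel₀ Real.pi_ne_zero (by linarith)
  exact_mod_cast this

lemma prod_dihedralCocycle_three (p : ℤ) :
    ∏ k ∈ Finset.range 3, dihedralCocycle 3 p (.r 1) (.r 1 ^ k) (.r 1) =
      Circle.exp (p * (2 * Real.pi / 3)) := by
  have h1 : (1 : ZMod 3).val = 1 := rfl
  have h2 : (2 : ZMod 3).val = 2 := rfl
  simp only [Finset.prod_range_succ, Finset.prod_range_zero, DihedralGroup.r_one_pow,
    dihedralCocycle, reflDeg, rotDeg, ← Circle.exp_add, one_mul]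
  congr 1
  norm_num [h1, h2]
  ring

lemma Trivializes.six_dvd {p : ℤ} {β : DihedralGroup 3 → DihedralGroup 3 → Circle}
    (h : Trivializes (dihedralCocycle 3 p) β) : 6 ∣ p := by
  have h2 : 2 ∣ p := by
    apply Circle.exp_int_mul_pi_eq_one
    rw [← dihedralCocycle_sr_zero (m := 3)]
    exact h.apply_involution (DihedralGroup.sr_mul_self 0) (dihedralCocycle_one_one p _).1
      (dihedralCocycle_one_one p _).2
  have h3 : 3 ∣ p := by
    apply Circle.exp_int_mul_two_pi_div_three_eq_one
    rw [← prod_dihedralCocycle_three]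
    exact h.prod_range_eq_one DihedralGroup.r_one_pow_n
  omega

/-- For `G = K = D₃` and `p ∈ {0,…,5}`: the Frobenius condition for `α^p` is solvable on
all of `D₃` iff `p ≡ 0 (mod 6)`; equivalently, for `p ∈ {1,…,5}` the cocycle `α^p` is not
a 3-coboundary on `D₃`. -/
theorem d3_full_group_boundary (p : ℤ) (hp : 0 ≤ p ∧ p ≤ 5) :
    ((∃ β : DihedralGroup 3 → DihedralGroup 3 → Circle,
        ∀ a b c : DihedralGroup 3,
          dihedralCocycle 3 p a b c * β b c * β a (b * c) *
            (β (a * b) c)⁻¹ * (β a b)⁻¹ = 1) ↔ p % 6 = 0) ∧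
    (1 ≤ p →
      ¬ ∃ cc : DihedralGroup 3 → DihedralGroup 3 → Circle,
          ∀ a b c' : DihedralGroup 3,
            dihedralCocycle 3 p a b c' =
              cc b c' * (cc (a * b) c')⁻¹ * cc a (b * c') * (cc a b)⁻¹) := by
  refine ⟨⟨fun ⟨β, hβ⟩ => Int.emod_eq_zero_of_dvd (Trivializes.six_dvd hβ), fun h => ?_⟩, ?_⟩
  · obtain rfl : p = 0 := by omega
    exact ⟨fun _ _ => 1, fun a b c => by simp [dihedralCocycle_zero]⟩
  · rintro hp1 ⟨cc, hcc⟩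
    have h6 : 6 ∣ p := by
      refine Trivializes.six_dvd (β := fun a b => (cc a b)⁻¹) fun a b c => ?_
      rw [hcc]
      simp [mul_assoc, mul_left_comm]
    omega
end
end

section
/- Let G = D₄ (dihedral group of order 8) and let α^p be the 3-cocycle on D₄ given by the dihedral cocycle formula with m = 4, for p ∈ {0,1,…,7}. Let K = {(0,0),(0,2),(1,0),(1,2)} ≅ Z₂×Z₂. Then: (i) there exists a 2-cochain β: K×K → U(1) satisfying the Frobenius condition with respect to α^p if and only if p is even; and (ii) when p is even, there exist two solutions β, β′ of the Frobenius condition that do not differ by a 2-coboundary, and every solution differs from one of these two by a 2-coboundary (i.e., there are exactly two equivalence classes of solutions modulo 2-coboundaries). -/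
noncomputable section

/-- The Klein four-subgroup `{(0,0),(0,2),(1,0),(1,2)} ≅ Z₂×Z₂` of `D₄`. -/
def kleinSubgroup : Subgroup (DihedralGroup 4) where
  carrier := {x | x = .r 0 ∨ x = .r 2 ∨ x = .sr 0 ∨ x = .sr 2}
  one_mem' := Or.inl DihedralGroup.one_def
  mul_mem' := by
    rintro a b (rfl | rfl | rfl | rfl) (rfl | rfl | rfl | rfl) <;>
      simp only [Set.mem_setOf_eq, DihedralGroup.r_mul_r, DihedralGroup.r_mul_sr,
        DihedralGroup.sr_mul_r, DihedralGroup.sr_mul_sr] <;> decide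
  inv_mem' := by rintro a (rfl | rfl | rfl | rfl) <;> decide

/-- Two 2-cochains on `K` differ by a 2-coboundary. -/
def CoboundEquiv {G : Type*} [Group G] {K : Subgroup G} (β β' : K → K → Circle) : Prop :=
  ∃ η : K → Circle, ∀ a b : K, β' a b = β a b * η a * η b * (η (a * b))⁻¹

lemma Circle.exists_mul_self_eq (u : Circle) : ∃ s : Circle, s * s = u := by
  obtain ⟨t, rfl⟩ := Circle.exp_surjective u
  exact ⟨Circle.exp (t / 2), by rw [← Circle.exp_add, add_halves]⟩

lemma isCocycle2_iff {K : Type*} [Group K] {γ : K → K → Circle} :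
    IsCocycle2 γ ↔ ∀ a b c : K, γ b c * γ a (b * c) = γ (a * b) c * γ a b := by
  refine forall_congr' fun a ↦ forall_congr' fun b ↦ forall_congr' fun c ↦ ?_
  rw [mul_inv_eq_one, mul_right_comm, mul_inv_eq_iff_eq_mul, mul_comm (γ a b)]

lemma frobeniusCondition_iff_isCocycle2 {G : Type*} [Group G] {K : Subgroup G}
    {α : G → G → G → Circle} (hα : ∀ a b c : K, α a b c = 1) {β : K → K → Circle} :
    FrobeniusCondition K α β ↔ IsCocycle2 β := by
  refine forall_congr' fun a ↦ forall_congr' fun b ↦ forall_congr' fun c ↦ ?_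
  rw [hα, one_mul, mul_right_comm (β b c)]

/-- On an involution at which `α` is normalized, a solution of the Frobenius condition forces
`α` to be trivial. -/
lemma FrobeniusCondition.apply_involution_eq_one {G : Type*} [Group G] {K : Subgroup G}
    {α : G → G → G → Circle} {β : K → K → Circle} (h : FrobeniusCondition K α β) {x : K}
    (hx : x * x = 1) (hα₁ : α x 1 1 = 1) (hα₂ : α 1 1 x = 1) : α x x x = 1 := by
  have h₁ := h x 1 1
  have h₂ := h 1 1 x
  have h₃ := h x x x
  simp only [OneMemClass.coe_one, hα₁, hα₂, mul_one, one_mul, mul_inv_cancel_right,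
    mul_inv_eq_one] at h₁ h₂
  rw [hx, ← h₁, ← h₂] at h₃
  simpa [mul_right_comm _ (β x x)] using h₃

lemma IsCocycle2.apply_one_left {K : Type*} [Group K] {γ : K → K → Circle} (h : IsCocycle2 γ)
    (a : K) : γ 1 a = γ 1 1 := by
  simpa using isCocycle2_iff.mp h 1 1 a

lemma IsCocycle2.apply_one_right {K : Type*} [Group K] {γ : K → K → Circle} (h : IsCocycle2 γ)
    (a : K) : γ a 1 = γ 1 1 := by
  simpa using (isCocycle2_iff.mp h a 1 1).symm

lemma CoboundEquiv.commute_iff {G : Type*} [Group G] {K : Subgroup G} {β β' : K → K → Circle}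
    (h : CoboundEquiv β β') {x y : K} (hxy : x * y = y * x) :
    β' x y = β' y x ↔ β x y = β y x := by
  obtain ⟨η, hη⟩ := h
  rw [hη, hη, hxy, mul_right_comm (β y x), mul_left_inj, mul_left_inj, mul_left_inj]

lemma dihedralCocycle_four_eq (p : ℤ) {x : DihedralGroup 4} (hx : Even (rotDeg x))
    (y z : DihedralGroup 4) : ∃ n : ℤ, dihedralCocycle 4 p x y z = Circle.exp (p * n * Real.pi) := by
  obtain ⟨a, ha⟩ := hx
  set w : ℤ := (-1) ^ reflDeg z * rotDeg y + rotDeg z with hw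
  refine ⟨(-1) ^ (reflDeg y + reflDeg z) * a * (w / 4) + reflDeg x * reflDeg y * reflDeg z, ?_⟩
  have hq : w - w % (4 : ℕ) = 4 * (w / 4) := by omega
  rw [dihedralCocycle, ← hw, hq, ha]
  congr 1
  push_cast
  ring

lemma dihedralCocycle_four_eq_one {p : ℤ} (hp : Even p) {x : DihedralGroup 4}
    (hx : Even (rotDeg x)) (y z : DihedralGroup 4) : dihedralCocycle 4 p x y z = 1 := by
  obtain ⟨n, hn⟩ := dihedralCocycle_four_eq p hx y z
  obtain ⟨k, rfl⟩ := hp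
  rw [hn, Circle.exp_eq_one]
  exact ⟨k * n, by push_cast; ring⟩

lemma dihedralCocycle_four_r_two (p : ℤ) :
    dihedralCocycle 4 p (.r 2) (.r 2) (.r 2) = Circle.exp (p * Real.pi) := by
  have h : ((2 : ZMod 4).val : ℤ) = 2 := rfl
  simp only [dihedralCocycle, reflDeg, rotDeg, h]
  congr 1
  norm_num
  ring

lemma dihedralCocycle_one_left (m : ℕ) [NeZero m] (p : ℤ) (y z : DihedralGroup m) :
    dihedralCocycle m p 1 y z = 1 := by
  simp [dihedralCocycle, DihedralGroup.one_def, reflDeg, rotDeg, -DihedralGroup.r_zero]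

lemma dihedralCocycle_one_one_right (m : ℕ) [NeZero m] (p : ℤ) (x : DihedralGroup m) :
    dihedralCocycle m p x 1 1 = 1 := by
  simp [dihedralCocycle, DihedralGroup.one_def, reflDeg, rotDeg, -DihedralGroup.r_zero]

/-- The rotation `(0,2)`. -/
def kleinR : kleinSubgroup := ⟨.r 2, Or.inr (Or.inl rfl)⟩

/-- The reflection `(1,0)`. -/
def kleinS : kleinSubgroup := ⟨.sr 0, Or.inr (Or.inr (Or.inl rfl))⟩

/-- The reflection `(1,2)`. -/
def kleinT : kleinSubgroup := ⟨.sr 2, Or.inr (Or.inr (Or.inr rfl))⟩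

lemma kleinSubgroup_cases (k : kleinSubgroup) :
    k = 1 ∨ k = kleinR ∨ k = kleinS ∨ k = kleinT := by
  obtain ⟨k, rfl | rfl | rfl | rfl⟩ := k
  exacts [Or.inl rfl, Or.inr (Or.inl rfl), Or.inr (Or.inr (Or.inl rfl)),
    Or.inr (Or.inr (Or.inr rfl))]

lemma even_rotDeg (k : kleinSubgroup) : Even (rotDeg (k : DihedralGroup 4)) := by
  obtain ⟨k, rfl | rfl | rfl | rfl⟩ := k <;> decide

@[simp] lemma kleinR_mul_kleinR : kleinR * kleinR = 1 := Subtype.ext (by decide)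
@[simp] lemma kleinR_mul_kleinS : kleinR * kleinS = kleinT := Subtype.ext (by decide)
@[simp] lemma kleinR_mul_kleinT : kleinR * kleinT = kleinS := Subtype.ext (by decide)
@[simp] lemma kleinS_mul_kleinR : kleinS * kleinR = kleinT := Subtype.ext (by decide)
@[simp] lemma kleinS_mul_kleinS : kleinS * kleinS = 1 := Subtype.ext (by decide)
@[simp] lemma kleinS_mul_kleinT : kleinS * kleinT = kleinR := Subtype.ext (by decide)
@[simp] lemma kleinT_mul_kleinR : kleinT * kleinR = kleinS := Subtype.ext (by decide)
@[simp] lemma kleinT_mul_kleinS : kleinT * kleinS = kleinR := Subtype.ext (by decide)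
@[simp] lemma kleinT_mul_kleinT : kleinT * kleinT = 1 := Subtype.ext (by decide)

/-- A function on the Klein four-subgroup, given by its values at `1`, `(0,2)`, `(1,0)`, `(1,2)`. -/
def kleinFun (e r s t : Circle) (k : kleinSubgroup) : Circle :=
  match (k : DihedralGroup 4) with
  | .r i => if i = 0 then e else r
  | .sr i => if i = 0 then s else t

section kleinFun

variable (e r s t : Circle)

@[simp] lemma kleinFun_one : kleinFun e r s t 1 = e := rfl
@[simp] lemma kleinFun_kleinR : kleinFun e r s t kleinR = r := rfl
@[simp] lemma kleinFun_kleinS : kleinFun e r s t kleinS = s := rfl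
@[simp] lemma kleinFun_kleinT : kleinFun e r s t kleinT = t := rfl

end kleinFun

/-- The 2-cochain `((A,a),(B,b)) ↦ u^{(a/2)·B}` on the Klein four-subgroup. -/
def kleinCochain (u : Circle) (a b : kleinSubgroup) : Circle :=
  kleinFun 1 (kleinFun 1 1 u u b) 1 (kleinFun 1 1 u u b) a

lemma isCocycle2_kleinCochain {u : Circle} (hu : u * u = 1) : IsCocycle2 (kleinCochain u) := by
  rw [isCocycle2_iff]
  intro a b c
  obtain rfl | rfl | rfl | rfl := kleinSubgroup_cases a <;>
  obtain rfl | rfl | rfl | rfl := kleinSubgroup_cases b <;>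
  obtain rfl | rfl | rfl | rfl := kleinSubgroup_cases c <;>
  simp [kleinCochain, hu]

lemma not_coboundEquiv_kleinCochain {u : Circle} (hu : u ≠ 1) :
    ¬ CoboundEquiv (kleinCochain 1) (kleinCochain u) := by
  intro h
  have := h.commute_iff (x := kleinR) (y := kleinS) (by simp)
  simp [kleinCochain, hu] at this

/-- Every 2-cocycle on the Klein four-subgroup is cohomologous to one of the cocycles
`kleinCochain u` with `u` of order at most two. -/
lemma IsCocycle2.exists_coboundEquiv_kleinCochain {γ : kleinSubgroup → kleinSubgroup → Circle}
    (h : IsCocycle2 γ) : ∃ u : Circle, u * u = 1 ∧ CoboundEquiv (kleinCochain u) γ := by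
  have h₁ := h.apply_one_left
  have h₂ := h.apply_one_right
  rw [isCocycle2_iff] at h
  have hrrs := h kleinR kleinR kleinS
  have hrss := h kleinR kleinS kleinS
  have hsrr := h kleinS kleinR kleinR
  have hssr := h kleinS kleinS kleinR
  have hrst := h kleinR kleinS kleinT
  have hrsr := h kleinR kleinS kleinR
  obtain ⟨s, hs⟩ := Circle.exists_mul_self_eq (γ kleinR kleinR * γ 1 1)
  obtain ⟨t, ht⟩ := Circle.exists_mul_self_eq (γ kleinS kleinS * γ 1 1)
  simp only [kleinR_mul_kleinR, kleinR_mul_kleinS, kleinS_mul_kleinR, kleinS_mul_kleinS,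
    kleinS_mul_kleinT, h₁ kleinR, h₁ kleinS, h₂ kleinR, h₂ kleinS]
    at hrrs hrss hsrr hssr hrst hrsr
  simp only [← Circle.coe_inj, Circle.coe_mul] at hrrs hrss hsrr hssr hrst hrsr hs ht
  have hu : (γ kleinR kleinS / γ kleinS kleinR) * (γ kleinR kleinS / γ kleinS kleinR) = 1 := by
    simp only [← Circle.coe_inj, Circle.coe_mul, Circle.coe_div, Circle.coe_one]
    have := Circle.coe_ne_zero
    grind
  refine ⟨γ kleinR kleinS / γ kleinS kleinR, hu,
    kleinFun (γ 1 1) s t (s * t / γ kleinS kleinR), fun a b ↦ ?_⟩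
  have hs₀ := s.coe_ne_zero
  have ht₀ := t.coe_ne_zero
  have hrs₀ := (γ kleinR kleinS).coe_ne_zero
  have hsr₀ := (γ kleinS kleinR).coe_ne_zero
  have h₀ := (γ 1 1).coe_ne_zero
  obtain rfl | rfl | rfl | rfl := kleinSubgroup_cases a <;>
  obtain rfl | rfl | rfl | rfl := kleinSubgroup_cases b <;>
  simp only [kleinCochain, h₁, h₂, kleinFun_one, kleinFun_kleinR, kleinFun_kleinS, kleinFun_kleinT,
    kleinR_mul_kleinR, kleinR_mul_kleinS, kleinR_mul_kleinT, kleinS_mul_kleinR,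
    kleinS_mul_kleinS, kleinS_mul_kleinT, kleinT_mul_kleinR, kleinT_mul_kleinS, kleinT_mul_kleinT,
    one_mul, mul_one, mul_inv_cancel_right, ← Circle.coe_inj, Circle.coe_mul,
    Circle.coe_inv, div_eq_mul_inv, mul_inv, inv_inv]
  all_goals grind

/-- For `G = D₄`, `K = {(0,0),(0,2),(1,0),(1,2)} ≅ Z₂×Z₂`, and `p ∈ {0,…,7}`:
(i) the Frobenius condition for `α^p` is solvable on `K` iff `p` is even; (ii) when `p` is
even there are exactly two equivalence classes of solutions modulo 2-coboundaries. -/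
theorem d4_klein_subgroup_boundary (p : ℤ) (hp : 0 ≤ p ∧ p ≤ 7) :
    ((∃ β : kleinSubgroup → kleinSubgroup → Circle,
        FrobeniusCondition kleinSubgroup (dihedralCocycle 4 p) β) ↔ Even p) ∧
    (Even p →
      ∃ β β' : kleinSubgroup → kleinSubgroup → Circle,
        FrobeniusCondition kleinSubgroup (dihedralCocycle 4 p) β ∧
        FrobeniusCondition kleinSubgroup (dihedralCocycle 4 p) β' ∧
        ¬ CoboundEquiv β β' ∧
        ∀ β'' : kleinSubgroup → kleinSubgroup → Circle,
          FrobeniusCondition kleinSubgroup (dihedralCocycle 4 p) β'' →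
            CoboundEquiv β β'' ∨ CoboundEquiv β' β'') := by
  have hiff (hp : Even p) (β : kleinSubgroup → kleinSubgroup → Circle) :
      FrobeniusCondition kleinSubgroup (dihedralCocycle 4 p) β ↔ IsCocycle2 β :=
    frobeniusCondition_iff_isCocycle2 fun a b c ↦
      dihedralCocycle_four_eq_one hp (even_rotDeg a) b c
  refine ⟨⟨?_, fun hp ↦ ⟨kleinCochain 1, (hiff hp _).mpr (isCocycle2_kleinCochain (mul_one 1))⟩⟩,
    fun hp ↦ ⟨kleinCochain 1, kleinCochain (-1), ?_⟩⟩
  · rintro ⟨β, hβ⟩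
    have h := hβ.apply_involution_eq_one kleinR_mul_kleinR (dihedralCocycle_one_one_right 4 p _)
      (dihedralCocycle_one_left 4 p 1 _)
    rw [kleinR, dihedralCocycle_four_r_two, Circle.exp_eq_one] at h
    obtain ⟨n, hn⟩ := h
    rw [mul_left_comm, ← mul_assoc, mul_left_inj' Real.pi_ne_zero] at hn
    exact even_iff_two_dvd.mpr ⟨n, by exact_mod_cast hn⟩
  · simp only [hiff hp]
    refine ⟨isCocycle2_kleinCochain (mul_one 1), isCocycle2_kleinCochain (by simp),
      not_coboundEquiv_kleinCochain (Circle.neg_ne_self 1), fun β hβ ↦ ?_⟩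
    obtain ⟨u, hu, h⟩ := hβ.exists_coboundEquiv_kleinCochain
    have : u = 1 ∨ u = -1 := by
      simpa [← Circle.coe_inj] using mul_self_eq_one_iff.mp (congrArg ((↑) : Circle → ℂ) hu)
    obtain rfl | rfl := this
    exacts [Or.inl h, Or.inr h]

end
end
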